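/- If T is a densely defined closed normal right linear operator with polar decomposition T = U₀|T| (with N(U₀) = N(T)), then U₀ restricts to a unitary operator on the closure of R(T), and U₀ commutes with |T| and with every bounded operator commuting with both T and T*. -/

import Mathlib

noncomputable section

open MulOpposite

local notation "ℍ" => Quaternion ℝ

variable {H : Type*} [NormedAddCommGroup H] [Module ℍᵐᵒᵖ H]

/-- The axioms of a quaternion-valued inner product compatible with the norm on a
right quaternionic module `H` (scalars act on the right via `ℍᵐᵒᵖ`). -/
structure QInner (inn : H → H → ℍ) : Prop where
  add_right : ∀ u v w : H, inn u (v + w) = inn u v + inn u w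
  smul_right : ∀ (u v : H) (q : ℍ), inn u (op q • v) = inn u v * q
  conj_symm : ∀ u v : H, inn u v = star (inn v u)
  norm_sq : ∀ u : H, inn u u = ((‖u‖ ^ 2 : ℝ) : ℍ)

/-- `B` is the adjoint of the bounded right linear operator `A`. -/
def IsAdjB (inn : H → H → ℍ) (A B : H →L[ℍᵐᵒᵖ] H) : Prop :=
  ∀ x y : H, inn (B x) y = inn x (A y)

/-- `A` is a positive bounded operator. -/
def IsPosB (inn : H → H → ℍ) (A : H →L[ℍᵐᵒᵖ] H) : Prop :=
  IsAdjB inn A A ∧ ∀ x : H, ∃ r : ℝ, 0 ≤ r ∧ inn x (A x) = (r : ℍ)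

/-- Orthogonal complement of a set. -/
def qOrth (inn : H → H → ℍ) (S : Set H) : Set H := {x | ∀ y ∈ S, inn y x = 0}

/-- Null space of a bounded operator. -/
def kerB (A : H →L[ℍᵐᵒᵖ] H) : Set H := {x | A x = 0}

/-- `U` is a partial isometry: it is isometric on `N(U)^⊥`. -/
def IsPartialIsomB (inn : H → H → ℍ) (U : H →L[ℍᵐᵒᵖ] H) : Prop :=
  ∀ x ∈ qOrth inn (kerB U), ‖U x‖ = ‖x‖

/-- Null space of an unbounded operator. -/
def pKer (T : H →ₗ.[ℍᵐᵒᵖ] H) : Set H := {x | ∃ hx : x ∈ T.domain, T ⟨x, hx⟩ = 0}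

/-- Range of an unbounded operator. -/
def pRan (T : H →ₗ.[ℍᵐᵒᵖ] H) : Set H := Set.range fun x : T.domain => T x

/-- `S` is the adjoint of the densely defined operator `T` : the formal adjoint
identity holds and the domain of `S` is maximal. -/
def IsAdjP (inn : H → H → ℍ) (T S : H →ₗ.[ℍᵐᵒᵖ] H) : Prop :=
  (∀ (x : S.domain) (y : T.domain), inn (x : H) (T y) = inn (S x) (y : H)) ∧
  ∀ x z : H, (∀ y : T.domain, inn x (T y) = inn z (y : H)) → x ∈ S.domain

/-- `T` is a positive (self-adjoint) unbounded operator. -/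
def IsPosP (inn : H → H → ℍ) (T : H →ₗ.[ℍᵐᵒᵖ] H) : Prop :=
  IsAdjP inn T T ∧ ∀ x : T.domain, ∃ r : ℝ, 0 ≤ r ∧ inn (x : H) (T x) = (r : ℍ)

/-- `C = S ∘ T` as unbounded operators, with the usual maximal domain. -/
def IsCompP (S T C : H →ₗ.[ℍᵐᵒᵖ] H) : Prop :=
  (∀ x : H, x ∈ C.domain ↔ ∃ hx : x ∈ T.domain, T ⟨x, hx⟩ ∈ S.domain) ∧
  ∀ (x : C.domain) (hx : (x : H) ∈ T.domain) (h2 : T ⟨x, hx⟩ ∈ S.domain),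
    C x = S ⟨T ⟨x, hx⟩, h2⟩

/-- `T = U ∘ P` where `U` is bounded and `T`, `P` are unbounded. -/
def EqCompB (T : H →ₗ.[ℍᵐᵒᵖ] H) (U : H →L[ℍᵐᵒᵖ] H) (P : H →ₗ.[ℍᵐᵒᵖ] H) : Prop :=
  T.domain = P.domain ∧
  ∀ (x : H) (hx : x ∈ T.domain) (hx' : x ∈ P.domain), T ⟨x, hx⟩ = U (P ⟨x, hx'⟩)

/-- The bounded operator `B` commutes with the unbounded operator `T`, i.e. `TB ⊆ BT`. -/
def CommP (B : H →L[ℍᵐᵒᵖ] H) (T : H →ₗ.[ℍᵐᵒᵖ] H) : Prop :=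
  ∀ x : T.domain, ∃ h : B (x : H) ∈ T.domain, T ⟨B (x : H), h⟩ = B (T x)



section RealPart

open scoped InnerProductSpace

variable {E : Type*} [NormedAddCommGroup E] [InnerProductSpace ℝ E] [CompleteSpace E]

/-- A continuous linear map vanishing on a subspace and on its orthogonal complement is zero. -/
theorem rp_ext (R : Submodule ℝ E) (f g : E →L[ℝ] E) (h1 : ∀ x ∈ R, f x = g x)
    (h2 : ∀ x ∈ Rᗮ, f x = g x) : f = g := by
  have hc : R.topologicalClosure ≤ LinearMap.ker ((f - g : E →L[ℝ] E) : E →ₗ[ℝ] E) := by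
    apply Submodule.topologicalClosure_minimal
    · intro x hx
      simp [h1 x hx]
    · exact (f - g).isClosed_ker
  have hk : Rᗮ ≤ LinearMap.ker ((f - g : E →L[ℝ] E) : E →ₗ[ℝ] E) := by
    intro x hx
    simp [h2 x hx]
  have htop : Rᗮ ⊔ Rᗮᗮ = ⊤ := Submodule.sup_orthogonal_of_hasOrthogonalProjection
  rw [Submodule.orthogonal_orthogonal_eq_closure] at htop
  have := sup_le hk hc
  rw [htop] at this
  ext x
  have hx := this (Submodule.mem_top (x := x))
  simpa [sub_eq_zero] using hx

/-- Bounded square root lemma. -/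
theorem rp_sqrt (G B : E →L[ℝ] E) (hsym : ∀ x y, ⟪G x, y⟫_ℝ = ⟪x, G y⟫_ℝ)
    (hpos : ∀ x, 0 ≤ ⟪G x, x⟫_ℝ) (hle : ∀ x, ‖G x‖ ≤ ‖x‖)
    (hB : ∀ x, B (G (G x)) = G (G (B x))) : ∀ x, B (G x) = G (B x) := by
  have hq : ∀ x, ‖G x‖ ^ 2 ≤ ⟪G x, x⟫_ℝ := by
    intro x
    have h := hpos (x - G x)
    have h2 : ⟪G (G x), G x⟫_ℝ ≤ ‖G x‖ ^ 2 := by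
      calc ⟪G (G x), G x⟫_ℝ ≤ ‖G (G x)‖ * ‖G x‖ := real_inner_le_norm _ _
        _ ≤ ‖G x‖ * ‖G x‖ := by gcongr; exact hle _
        _ = _ := by ring
    rw [map_sub, inner_sub_left, inner_sub_right, inner_sub_right, hsym (G x) x,
      real_inner_self_eq_norm_sq] at h
    linarith
  have hcon : ∀ x, ‖x - G x‖ ≤ ‖x‖ := by
    intro x
    apply le_of_sq_le_sq _ (norm_nonneg _)
    rw [norm_sub_sq_real, real_inner_comm]
    have := hq x
    have := hpos x
    linarith
  have hexp : ∀ x, ‖x‖ ^ 2 + ‖G x‖ ^ 2 ≤ ‖x + G x‖ ^ 2 := by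
    intro x
    rw [norm_add_sq_real, real_inner_comm]
    have := hpos x
    linarith
  let X : E →L[ℝ] E := G.comp B - B.comp G
  have hX : ∀ x, X x = G (B x) - B (G x) := fun x => rfl
  have hanti : ∀ x, G (X x) = - X (G x) := by
    intro x
    simp only [hX, map_sub, hB]
    abel
  have key : ∀ n : ℕ, ∀ x, (n : ℝ) * ‖G (X x)‖ ^ 2 ≤ (‖X‖ * ‖x‖) ^ 2 := by
    have aux : ∀ n : ℕ, ∀ x, ∃ w, ‖w‖ ≤ ‖x‖ ∧ ‖G (X x)‖ ^ 2 ≤ ‖G (X w)‖ ^ 2 ∧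
        (n : ℝ) * ‖G (X x)‖ ^ 2 ≤ ‖X w‖ ^ 2 := by
      intro n x
      induction n with
      | zero => exact ⟨x, le_rfl, le_rfl, by simp⟩
      | succ k ih =>
        obtain ⟨w, h1, h2, h3⟩ := ih
        have e : X (w - G w) = X w + G (X w) := by rw [hanti, map_sub]; abel
        refine ⟨w - G w, (hcon w).trans h1, ?_, ?_⟩
        · rw [e, map_add]
          have := hexp (G (X w))
          have := sq_nonneg ‖G (G (X w))‖
          linarith
        · rw [e]
          have := hexp (X w)
          push_cast
          linarith
    intro n x
    obtain ⟨w, h1, h2, h3⟩ := aux n x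
    refine h3.trans ?_
    have : ‖X w‖ ≤ ‖X‖ * ‖x‖ := (X.le_opNorm w).trans (by gcongr)
    gcongr
  have hGX : ∀ x, G (X x) = 0 := by
    intro x
    by_contra hne
    have hp : 0 < ‖G (X x)‖ ^ 2 := by positivity
    obtain ⟨n, hn⟩ := exists_nat_gt ((‖X‖ * ‖x‖) ^ 2 / ‖G (X x)‖ ^ 2)
    rw [div_lt_iff₀ hp] at hn
    exact absurd (key n x) (not_le.mpr hn)
  have hfin : B.comp G = G.comp B := by
    apply rp_ext (LinearMap.range (G : E →ₗ[ℝ] E))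
    · rintro _ ⟨x, rfl⟩
      have h1 := hGX x
      rw [hanti, neg_eq_zero, hX, sub_eq_zero] at h1
      exact h1.symm
    · intro z hz
      have hz0 : G z = 0 := by
        have := (Submodule.mem_orthogonal _ _).1 hz (G (G z)) ⟨G z, rfl⟩
        rw [hsym] at this
        exact inner_self_eq_zero.1 this
      have h2 := hB z
      rw [hz0, map_zero, map_zero] at h2
      have h3 : ⟪G (B z), G (B z)⟫_ℝ = 0 := by
        rw [← hsym, ← h2, inner_zero_left]
      have h4 := inner_self_eq_zero.1 h3
      simp [hz0, h4]
  intro x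
  exact congrArg (fun f : E →L[ℝ] E => f x) hfin

/-- Resolvent of the square of a self-adjoint operator given by its graph. -/
theorem rp_resolvent (A : Submodule ℝ (E × E))
    (hA : ∀ x z, (x, z) ∈ A ↔ ∀ y w, (y, w) ∈ A → ⟪x, w⟫_ℝ = ⟪z, y⟫_ℝ) :
    ∃ S G : E →L[ℝ] E, (∀ h, (S h, G h) ∈ A ∧ (G h, h - S h) ∈ A) ∧ (∀ h, ‖G h‖ ≤ ‖h‖) ∧
      ∀ x y z, (x, y) ∈ A → (y, z) ∈ A → x = S (x + z) ∧ y = G (x + z) := by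
  have hex : ∀ h : E, ∃ p : E × E, (p.1, p.2) ∈ A ∧ (p.2, h - p.1) ∈ A := by
    intro h
    let e := WithLp.linearEquiv 2 ℝ (E × E)
    let A2 : Submodule ℝ (WithLp 2 (E × E)) := A.comap e.toLinearMap
    have hcl : IsClosed (A2 : Set (WithLp 2 (E × E))) := by
      have : (A2 : Set (WithLp 2 (E × E))) =
          ⋂ y : E, ⋂ w : E, ⋂ _ : (y, w) ∈ A,
            {p | ⟪p.fst, w⟫_ℝ = ⟪p.snd, y⟫_ℝ} := by
        ext p
        simp only [Set.mem_iInter, Set.mem_ofPred_eq]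
        exact hA p.fst p.snd
      rw [this]
      refine isClosed_iInter fun y => isClosed_iInter fun w => isClosed_iInter fun _ => ?_
      apply isClosed_eq <;> fun_prop
    have : CompleteSpace A2 := hcl.completeSpace_coe
    let v : WithLp 2 (E × E) := WithLp.toLp 2 (h, 0)
    obtain ⟨p, hp, hv⟩ := Submodule.HasOrthogonalProjection.exists_orthogonal (K := A2) v
    refine ⟨(p.fst, p.snd), hp, ?_⟩
    rw [hA]
    intro y w hyw
    have h0 := (Submodule.mem_orthogonal _ _).1 hv (WithLp.toLp 2 (y, w)) hyw
    rw [WithLp.prod_inner_apply] at h0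
    simp only [v] at h0
    have h1 : ⟪y, h - p.fst⟫_ℝ + ⟪w, 0 - p.snd⟫_ℝ = 0 := h0
    rw [zero_sub, inner_neg_right] at h1
    rw [real_inner_comm, real_inner_comm y]
    show ⟪w, p.snd⟫_ℝ = ⟪y, h - p.fst⟫_ℝ
    linarith
  have hnorm : ∀ x y z, (x, y) ∈ A → (y, z) ∈ A → ‖x‖ ≤ ‖x + z‖ ∧ ‖y‖ ≤ ‖x + z‖ := by
    intro x y z h1 h2
    have h3 := (hA y z).1 h2 x y h1
    have h4 : ‖x‖ ^ 2 + ‖y‖ ^ 2 = ⟪x + z, x⟫_ℝ := by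
      rw [inner_add_left, ← h3, real_inner_self_eq_norm_sq, real_inner_self_eq_norm_sq]
    have h5 := real_inner_le_norm (x + z) x
    have hx := norm_nonneg x
    have hy := norm_nonneg y
    have hxz := norm_nonneg (x + z)
    constructor
    · by_contra! hc
      nlinarith
    · by_contra! hc
      nlinarith [sq_nonneg (‖x‖ - ‖x + z‖)]
  have huniq : ∀ x y z x' y' z', (x, y) ∈ A → (y, z) ∈ A → (x', y') ∈ A → (y', z') ∈ A →
      x + z = x' + z' → x = x' ∧ y = y' := by
    intro x y z x' y' z' h1 h2 h3 h4 h
    have := hnorm (x - x') (y - y') (z - z') (A.sub_mem h1 h3) (A.sub_mem h2 h4)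
    have e : x - x' + (z - z') = 0 := by
      rw [← sub_eq_zero] at h
      rw [← h]; abel
    rw [e, norm_zero] at this
    exact ⟨sub_eq_zero.1 (norm_le_zero_iff.1 this.1), sub_eq_zero.1 (norm_le_zero_iff.1 this.2)⟩
  choose p hp1 hp2 using hex
  have hadd : ∀ a b, (p (a + b)).1 = (p a).1 + (p b).1 ∧ (p (a + b)).2 = (p a).2 + (p b).2 := by
    intro a b
    exact huniq _ _ _ _ _ _ (hp1 _) (hp2 _) (A.add_mem (hp1 a) (hp1 b))
      (A.add_mem (hp2 a) (hp2 b)) (by simp; abel)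
  have hsmul : ∀ (c : ℝ) a, (p (c • a)).1 = c • (p a).1 ∧ (p (c • a)).2 = c • (p a).2 := by
    intro c a
    exact huniq _ _ _ _ _ _ (hp1 _) (hp2 _) (A.smul_mem c (hp1 a))
      (A.smul_mem c (hp2 a)) (by simp [smul_sub])
  have hpn : ∀ a, ‖(p a).1‖ ≤ ‖a‖ ∧ ‖(p a).2‖ ≤ ‖a‖ := by
    intro a
    have := hnorm _ _ _ (hp1 a) (hp2 a)
    rwa [add_sub_cancel] at this
  let S0 : E →ₗ[ℝ] E :=
    { toFun := fun a => (p a).1, map_add' := fun a b => (hadd a b).1,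
      map_smul' := fun c a => (hsmul c a).1 }
  let G0 : E →ₗ[ℝ] E :=
    { toFun := fun a => (p a).2, map_add' := fun a b => (hadd a b).2,
      map_smul' := fun c a => (hsmul c a).2 }
  refine ⟨S0.mkContinuous 1 (fun a => by rw [one_mul]; exact (hpn a).1),
    G0.mkContinuous 1 (fun a => by rw [one_mul]; exact (hpn a).2),
    fun h => ⟨hp1 h, hp2 h⟩, fun h => (hpn h).2, ?_⟩
  intro x y z h1 h2
  exact huniq _ _ _ _ _ _ h1 h2 (hp1 (x + z)) (hp2 (x + z))
    (add_sub_cancel _ _).symm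

/-- The whole theorem for graphs in a real Hilbert space. -/
theorem rp_main (T Ts A : Submodule ℝ (E × E)) (U : E →L[ℝ] E)
    (fA : ∀ x y y', (x, y) ∈ A → (x, y') ∈ A → y = y')
    (hadj : ∀ x z, (x, z) ∈ Ts ↔ ∀ y w, (y, w) ∈ T → ⟪x, w⟫_ℝ = ⟪z, y⟫_ℝ)
    (hA : ∀ x z, (x, z) ∈ A ↔ ∀ y w, (y, w) ∈ A → ⟪x, w⟫_ℝ = ⟪z, y⟫_ℝ)
    (hpos : ∀ x y, (x, y) ∈ A → 0 ≤ ⟪x, y⟫_ℝ)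
    (hsq : ∀ x z, (∃ y, (x, y) ∈ T ∧ (y, z) ∈ Ts) ↔ ∃ y, (x, y) ∈ A ∧ (y, z) ∈ A)
    (hsq' : ∀ x z, (∃ y, (x, y) ∈ Ts ∧ (y, z) ∈ T) ↔ ∃ y, (x, y) ∈ A ∧ (y, z) ∈ A)
    (hfact : ∀ x y, (x, y) ∈ T ↔ ∃ w, (x, w) ∈ A ∧ y = U w)
    (hU : ∀ x, (∀ y, U y = 0 → ⟪y, x⟫_ℝ = 0) → ‖U x‖ = ‖x‖)
    (hker : ∀ x, U x = 0 ↔ (x, 0) ∈ T) :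
    (∀ x ∈ closure {y | ∃ x, (x, y) ∈ T}, U x ∈ closure {y | ∃ x, (x, y) ∈ T}) ∧
    (∀ x ∈ closure {y | ∃ x, (x, y) ∈ T}, ‖U x‖ = ‖x‖) ∧
    (∀ y ∈ closure {y | ∃ x, (x, y) ∈ T}, ∃ x ∈ closure {y | ∃ x, (x, y) ∈ T}, U x = y) ∧
    (∀ x y, (x, y) ∈ A → (U x, U y) ∈ A) ∧
    (∀ B : E →L[ℝ] E, (∀ x y, (x, y) ∈ T → (B x, B y) ∈ T) →
      (∀ x y, (x, y) ∈ Ts → (B x, B y) ∈ Ts) → ∀ x, U (B x) = B (U x)) := by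
  obtain ⟨S, G, hSG, hGn, hun⟩ := rp_resolvent A hA
  have hTA : ∀ x, (x, (0 : E)) ∈ T ↔ (x, (0 : E)) ∈ A := by
    intro x
    constructor
    · intro h
      obtain ⟨y, h1, h2⟩ := (hsq x 0).1 ⟨0, h, Ts.zero_mem⟩
      have h3 := (hA y 0).1 h2 x y h1
      rw [inner_zero_left] at h3
      rwa [inner_self_eq_zero.1 h3] at h1
    · intro h
      exact (hfact x 0).2 ⟨0, h, by simp⟩
  have hTsA : ∀ x, (x, (0 : E)) ∈ Ts ↔ (x, (0 : E)) ∈ A := by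
    intro x
    constructor
    · intro h
      obtain ⟨y, h1, h2⟩ := (hsq' x 0).1 ⟨0, h, T.zero_mem⟩
      have h3 := (hA y 0).1 h2 x y h1
      rw [inner_zero_left] at h3
      rwa [inner_self_eq_zero.1 h3] at h1
    · intro h
      obtain ⟨y, h1, h2⟩ := (hsq' x 0).2 ⟨0, h, A.zero_mem⟩
      have h3 := (hadj x y).1 h1 y 0 h2
      rw [inner_zero_right] at h3
      rwa [inner_self_eq_zero.1 h3.symm] at h1
  have hkA : ∀ x, U x = 0 ↔ (x, (0 : E)) ∈ A := fun x => (hker x).trans (hTA x)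
  let K : Submodule ℝ E := LinearMap.ker (U : E →ₗ[ℝ] E)
  have hK : ∀ x, x ∈ K ↔ U x = 0 := fun x => Iff.rfl
  let RA : Submodule ℝ E := A.map (LinearMap.snd ℝ E E)
  let RT : Submodule ℝ E := T.map (LinearMap.snd ℝ E E)
  have mRA : ∀ y, y ∈ RA ↔ ∃ x, (x, y) ∈ A := by
    intro y; simp [RA]
  have mRT : ∀ y, y ∈ RT ↔ ∃ x, (x, y) ∈ T := by
    intro y; simp [RT]
  have oRA : RAᗮ = K := by
    ext z
    rw [Submodule.mem_orthogonal', hK, hkA, hA]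
    simp only [mRA, inner_zero_left]
    exact ⟨fun h y w hyw => h w ⟨y, hyw⟩, fun h w ⟨y, hyw⟩ => h y w hyw⟩
  have oRT : RTᗮ = K := by
    ext z
    rw [Submodule.mem_orthogonal', hK, hkA, ← hTsA, hadj]
    simp only [mRT, inner_zero_left]
    exact ⟨fun h y w hyw => h w ⟨y, hyw⟩, fun h w ⟨y, hyw⟩ => h y w hyw⟩
  have cRA : RA.topologicalClosure = Kᗮ := by
    rw [← Submodule.orthogonal_orthogonal_eq_closure, oRA]
  have cRT : RT.topologicalClosure = Kᗮ := by
    rw [← Submodule.orthogonal_orthogonal_eq_closure, oRT]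
  have hset : closure {y | ∃ x, (x, y) ∈ T} = (Kᗮ : Set E) := by
    rw [← cRT, Submodule.topologicalClosure_coe]
    congr 1
    ext y
    exact (mRT y).symm
  have c2 : ∀ x ∈ Kᗮ, ‖U x‖ = ‖x‖ := fun x hx =>
    hU x fun y hy => (Submodule.mem_orthogonal _ _).1 hx y hy
  -- extension principle
  have hext : ∀ f g : E →L[ℝ] E, (∀ x y, (x, y) ∈ A → f y = g y) →
      (∀ x, (x, (0 : E)) ∈ A → f x = g x) → ∀ x, f x = g x := by
    intro f g h1 h2 x
    have : f = g := by
      apply rp_ext RA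
      · intro y hy
        obtain ⟨x, hx⟩ := (mRA y).1 hy
        exact h1 x y hx
      · intro x hx
        rw [oRA, hK, hkA] at hx
        exact h2 x hx
    rw [this]
  have hSA : ∀ x y, (x, y) ∈ A → G x = S y := by
    intro x y h
    have := (hun (G x) (x - S x) (y - G x) (hSG x).2 (A.sub_mem h (hSG x).1)).1
    rwa [add_sub_cancel] at this
  have hSA' : ∀ x y, (x, y) ∈ A → (S x, S y) ∈ A := by
    intro x y h
    rw [← hSA x y h]
    exact (hSG x).1
  have hST : ∀ x y, (x, y) ∈ T → (S x, S y) ∈ T := by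
    intro x y h
    obtain ⟨w, h1, h2⟩ := (hsq (S x) (x - S x)).2 ⟨G x, hSG x⟩
    have h3 : (x - S x, y - w) ∈ T := T.sub_mem h h1
    obtain ⟨u, h4, h5⟩ := (hsq' w (y - w)).1 ⟨_, h2, h3⟩
    have h6 := (hun _ _ _ h4 h5).1
    rw [add_sub_cancel] at h6
    rwa [← h6]
  have hGsym : ∀ x y, ⟪G x, y⟫_ℝ = ⟪x, G y⟫_ℝ := by
    intro x y
    have h1 := (hA _ _).1 (hSG x).2 _ _ (hSG y).2
    have h2 := (hA _ _).1 (hSG x).1 _ _ (hSG y).1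
    rw [inner_sub_right, inner_sub_left] at h1
    linarith
  have hGpos : ∀ x, 0 ≤ ⟪G x, x⟫_ℝ := by
    intro x
    have h1 := hpos _ _ (hSG x).2
    have h2 := hpos _ _ (hSG x).1
    rw [inner_sub_right] at h1
    rw [real_inner_comm] at h2
    linarith
  have hGG : ∀ x, G (G x) = S (x - S x) := fun x => hSA _ _ (hSG x).2
  have hcomm : ∀ B : E →L[ℝ] E, (∀ x, B (S x) = S (B x)) → ∀ x y, (x, y) ∈ A →
      (B x, B y) ∈ A := by
    intro B hB x y hxy
    have hBG := rp_sqrt G B hGsym hGpos hGn (by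
      intro x
      rw [hGG, hGG, hB, map_sub, hB])
    have e : S (B y) = G (B x) := by
      rw [← hB, ← hSA x y hxy, hBG]
    obtain ⟨h1, h2⟩ := hSG (B x)
    obtain ⟨h3, h4⟩ := hSG (B y)
    rw [← e] at h1 h2
    have e2 := fA _ _ _ h3 h2
    rw [e2] at h4
    have := A.add_mem h1 h4
    simpa using this
  refine ⟨?_, ?_, ?_, ?_, ?_⟩
  · rw [hset]
    have : Kᗮ ≤ Kᗮ.comap (U : E →ₗ[ℝ] E) := by
      rw [← cRA]
      apply Submodule.topologicalClosure_minimal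
      · intro y hy
        obtain ⟨x, hx⟩ := (mRA y).1 hy
        rw [cRA, ← cRT]
        exact RT.le_topologicalClosure ((mRT _).2 ⟨x, (hfact _ _).2 ⟨y, hx, rfl⟩⟩)
      · rw [cRA]
        exact (Submodule.isClosed_orthogonal K).preimage U.continuous
    exact fun x hx => this hx
  · rw [hset]
    exact c2
  · rw [hset]
    have hiso : Isometry (fun x : Kᗮ => U (x : E)) := by
      apply Isometry.of_dist_eq
      intro x y
      rw [dist_eq_norm, ← map_sub, c2 _ (Kᗮ.sub_mem x.2 y.2), ← dist_eq_norm]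
      rfl
    have hcl := hiso.isClosedEmbedding.isClosed_range
    intro y hy
    have hy' : y ∈ closure (RT : Set E) := by
      rw [← Submodule.topologicalClosure_coe, cRT]; exact hy
    have hsub : (RT : Set E) ⊆ Set.range (fun x : Kᗮ => U (x : E)) := by
      intro y hy
      obtain ⟨x, hx⟩ := (mRT y).1 hy
      obtain ⟨w, hw, rfl⟩ := (hfact _ _).1 hx
      refine ⟨⟨w, ?_⟩, rfl⟩
      rw [← cRA]
      exact RA.le_topologicalClosure ((mRA _).2 ⟨x, hw⟩)
    obtain ⟨x, hx⟩ := closure_minimal hsub hcl hy'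
    exact ⟨x, x.2, hx⟩
  · apply hcomm
    apply hext (U.comp S) (S.comp U)
    · intro x y h
      have h1 := hST _ _ ((hfact x (U y)).2 ⟨y, h, rfl⟩)
      obtain ⟨w, h2, h3⟩ := (hfact _ _).1 h1
      have := fA _ _ _ h2 (hSA' x y h)
      rw [this] at h3
      exact h3.symm
    · intro x h
      have h1 := (hun x 0 0 h A.zero_mem).1
      rw [add_zero] at h1
      have h2 := (hkA x).2 h
      simp [← h1, h2]
  · intro B hBT hBTs
    have hBS : ∀ x, B (S x) = S (B x) := by
      intro x
      obtain ⟨w, h1, h2⟩ := (hsq (S x) (x - S x)).2 ⟨G x, hSG x⟩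
      obtain ⟨y, h3, h4⟩ := (hsq _ _).1 ⟨_, hBT _ _ h1, hBTs _ _ h2⟩
      have h5 := (hun _ _ _ h3 h4).1
      rwa [← map_add, add_sub_cancel] at h5
    have hBA := hcomm B hBS
    apply hext (U.comp B) (B.comp U)
    · intro x y h
      have h1 := hBT _ _ ((hfact x (U y)).2 ⟨y, h, rfl⟩)
      obtain ⟨w, h2, h3⟩ := (hfact _ _).1 h1
      rw [fA _ _ _ h2 (hBA _ _ h)] at h3
      exact h3.symm
    · intro x h
      have h1 := hBA _ _ h
      rw [map_zero, ← hkA] at h1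
      have h2 := (hkA x).2 h
      simp [h1, h2]

end RealPart


section Transfer

theorem q_re_ext (a b : ℍ) (h : ∀ q : ℍ, (a * q).re = (b * q).re) : a = b := by
  have h1 := h (star (a - b))
  rw [← sub_eq_zero, ← Quaternion.re_sub, ← sub_mul, Quaternion.self_mul_star] at h1
  rw [← sub_eq_zero]
  exact Quaternion.normSq_eq_zero.1 (by simpa using h1)

/-- Real scalars acting through quaternions. -/
@[reducible] def realMod : Module ℝ H := Module.compHom H (algebraMap ℝ ℍᵐᵒᵖ)

theorem QInner.add_left {inn : H → H → ℍ} (hinn : QInner inn) (u v w : H) :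
    inn (u + v) w = inn u w + inn v w := by
  rw [hinn.conj_symm, hinn.add_right, star_add, ← hinn.conj_symm, ← hinn.conj_symm]

theorem QInner.re_symm {inn : H → H → ℍ} (hinn : QInner inn) (u v : H) :
    (inn u v).re = (inn v u).re := by
  rw [hinn.conj_symm, Quaternion.re_star]

theorem QInner.norm_smul {inn : H → H → ℍ} (hinn : QInner inn) (q : ℍ) (u : H) :
    ‖op q • u‖ ^ 2 = ‖q‖ ^ 2 * ‖u‖ ^ 2 := by
  have h1 := hinn.norm_sq (op q • u)
  rw [hinn.smul_right, hinn.conj_symm, hinn.smul_right, hinn.norm_sq, star_mul,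
    Quaternion.star_coe, mul_assoc, Quaternion.coe_mul_eq_smul, mul_smul_comm,
    Quaternion.star_mul_self, ← Quaternion.coe_smul] at h1
  have h2 := Quaternion.coe_injective h1
  rw [← h2, Quaternion.normSq_eq_norm_mul_self, smul_eq_mul]
  ring

/-- Real Hilbert space structure on a quaternionic Hilbert space. -/
@[reducible] def realIPS (inn : H → H → ℍ) (hinn : QInner inn) : InnerProductSpace ℝ H :=
  { realMod with
    norm_smul_le := by
      intro r x
      have h := hinn.norm_smul (r : ℍ) x
      rw [← mul_pow] at h
      have h2 := (sq_eq_sq₀ (norm_nonneg _) (by positivity)).1 h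
      rw [Quaternion.norm_coe] at h2
      exact h2.le
    inner := fun x y => (inn x y).re
    norm_sq_eq_re_inner := by
      intro x
      rw [hinn.norm_sq]
      rfl
    conj_inner_symm := by
      intro x y
      exact hinn.re_symm y x
    add_left := by
      intro x y z
      simp [hinn.add_left]
    smul_left := by
      intro x y r
      have h : (inn (op (r : ℍ) • x) y).re = r * (inn x y).re := by
        rw [hinn.re_symm, hinn.smul_right, hinn.re_symm x y, Quaternion.mul_coe_eq_smul]
        simp
      exact h }

theorem pmem (T : H →ₗ.[ℍᵐᵒᵖ] H) (x y : H) :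
    (x, y) ∈ T.graph ↔ ∃ hx : x ∈ T.domain, T ⟨x, hx⟩ = y := by
  rw [LinearPMap.mem_graph_iff]
  constructor
  · rintro ⟨⟨z, hz⟩, rfl, h⟩
    exact ⟨hz, h⟩
  · rintro ⟨hx, h⟩
    exact ⟨⟨x, hx⟩, rfl, h⟩

theorem adj_graph {inn : H → H → ℍ} (hinn : QInner inn) (T S : H →ₗ.[ℍᵐᵒᵖ] H)
    (hd : Dense (T.domain : Set H)) (h : IsAdjP inn T S) (x z : H) :
    (x, z) ∈ S.graph ↔ ∀ y w, (y, w) ∈ T.graph → (inn x w).re = (inn z y).re := by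
  constructor
  · intro hx0 y w hy0
    obtain ⟨hx, rfl⟩ := (pmem _ _ _).1 hx0
    obtain ⟨hy, rfl⟩ := (pmem _ _ _).1 hy0
    rw [h.1 ⟨x, hx⟩ ⟨y, hy⟩]
  · intro hx
    have hx' : ∀ y : T.domain, inn x (T y) = inn z (y : H) := by
      intro y
      apply q_re_ext
      intro q
      rw [← hinn.smul_right, ← hinn.smul_right, ← LinearPMap.map_smul]
      exact hx _ _ (LinearPMap.mem_graph T (op q • y))
    have hxS := h.2 x z hx'
    refine (pmem _ _ _).2 ⟨hxS, ?_⟩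
    letI := realIPS inn hinn
    have h0 : ∀ y ∈ T.domain, inner ℝ (S ⟨x, hxS⟩) y = inner ℝ z y := by
      intro y hy
      have h1 := h.1 ⟨x, hxS⟩ ⟨y, hy⟩
      rw [hx' ⟨y, hy⟩] at h1
      exact congrArg QuaternionAlgebra.re h1.symm
    apply ext_inner_right ℝ
    intro v
    have hc : Set.EqOn (fun v => inner ℝ (S ⟨x, hxS⟩) v) (fun v => inner ℝ z v) Set.univ := by
      rw [← hd.closure_eq]
      apply Set.EqOn.closure (fun y hy => h0 y hy) <;> fun_prop
    exact hc (Set.mem_univ v)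

theorem comp_graph (S T C : H →ₗ.[ℍᵐᵒᵖ] H) (h : IsCompP S T C) (x z : H) :
    (x, z) ∈ C.graph ↔ ∃ y, (x, y) ∈ T.graph ∧ (y, z) ∈ S.graph := by
  constructor
  · intro hx0
    obtain ⟨hx, rfl⟩ := (pmem _ _ _).1 hx0
    obtain ⟨h1, h2⟩ := (h.1 x).1 hx
    exact ⟨T ⟨x, h1⟩, (pmem _ _ _).2 ⟨h1, rfl⟩, (pmem _ _ _).2 ⟨h2, (h.2 ⟨x, hx⟩ h1 h2).symm⟩⟩
  · rintro ⟨y, h10, h20⟩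
    obtain ⟨h1, rfl⟩ := (pmem _ _ _).1 h10
    obtain ⟨h2, rfl⟩ := (pmem _ _ _).1 h20
    have hx := (h.1 x).2 ⟨h1, h2⟩
    exact (pmem _ _ _).2 ⟨hx, h.2 ⟨x, hx⟩ h1 h2⟩

theorem commP_iff (B : H →L[ℍᵐᵒᵖ] H) (T : H →ₗ.[ℍᵐᵒᵖ] H) :
    CommP B T ↔ ∀ x y, (x, y) ∈ T.graph → (B x, B y) ∈ T.graph := by
  constructor
  · intro h x y hxy
    obtain ⟨hx, rfl⟩ := (pmem _ _ _).1 hxy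
    exact (pmem _ _ _).2 (h ⟨x, hx⟩)
  · intro h x
    exact (pmem _ _ _).1 (h x (T x) (LinearPMap.mem_graph T x))

end Transfer

/-- if `T` is densely defined, closed and normal (`T*T = TT*`) with polar
decomposition `T = U₀ |T|`, `N(U₀) = N(T)`, then `U₀` restricts to a unitary operator on
`closure (R(T))`, commutes with `|T|`, and commutes with every bounded operator
commuting with both `T` and `T*`. -/
theorem polar_decomposition_normal
    [CompleteSpace H] (inn : H → H → ℍ) (hinn : QInner inn)
    (T Ts TsT TTs modT : H →ₗ.[ℍᵐᵒᵖ] H) (U₀ : H →L[ℍᵐᵒᵖ] H)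
    (hdense : Dense (T.domain : Set H))
    (hclosed : IsClosed (T.graph : Set (H × H)))
    (hadj : IsAdjP inn T Ts)
    (hcomp : IsCompP Ts T TsT) (hcomp' : IsCompP T Ts TTs)
    (hnormal : TsT = TTs)
    (hmodpos : IsPosP inn modT) (hmodsq : IsCompP modT modT TsT)
    (hU : IsPartialIsomB inn U₀) (hker : kerB U₀ = pKer T)
    (hfact : EqCompB T U₀ modT) :
    (∀ x ∈ closure (pRan T), U₀ x ∈ closure (pRan T)) ∧
    (∀ x ∈ closure (pRan T), ‖U₀ x‖ = ‖x‖) ∧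
    (∀ y ∈ closure (pRan T), ∃ x ∈ closure (pRan T), U₀ x = y) ∧
    CommP U₀ modT ∧
    (∀ B : H →L[ℍᵐᵒᵖ] H, CommP B T → CommP B Ts → U₀.comp B = B.comp U₀) := by
  letI := realIPS inn hinn
  have : IsScalarTower ℝ ℍᵐᵒᵖ H := IsScalarTower.of_algebraMap_smul fun r x => rfl
  have hdenseA : Dense (modT.domain : Set H) := hfact.1 ▸ hdense
  have hran : pRan T = {y | ∃ x, (x, y) ∈ T.graph} := by
    ext y
    constructor
    · rintro ⟨x, rfl⟩
      exact ⟨x, LinearPMap.mem_graph T x⟩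
    · rintro ⟨x, hx0⟩
      obtain ⟨hx, rfl⟩ := (pmem _ _ _).1 hx0
      exact ⟨⟨x, hx⟩, rfl⟩
  have hsq := comp_graph _ _ _ hmodsq
  have hc1 := comp_graph _ _ _ hcomp
  have hc2 := comp_graph _ _ _ hcomp'
  rw [← hnormal] at hc2
  have hkm : ∀ x, U₀ x = 0 ↔ (x, (0 : H)) ∈ T.graph := by
    intro x
    rw [pmem]
    exact Set.ext_iff.1 hker x
  obtain ⟨r1, r2, r3, r4, r5⟩ := rp_main (E := H) (T.graph.restrictScalars ℝ)
    (Ts.graph.restrictScalars ℝ) (modT.graph.restrictScalars ℝ) (U₀.restrictScalars ℝ)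
    (by
      intro x y y' h h'
      obtain ⟨_, rfl⟩ := (pmem _ _ _).1 h
      obtain ⟨_, rfl⟩ := (pmem _ _ _).1 h'
      rfl)
    (adj_graph hinn T Ts hdense hadj)
    (adj_graph hinn modT modT hdenseA hmodpos.1)
    (by
      intro x y h
      obtain ⟨hx, rfl⟩ := (pmem _ _ _).1 h
      obtain ⟨r, hr, he⟩ := hmodpos.2 ⟨x, hx⟩
      change 0 ≤ (inn x (modT ⟨x, hx⟩)).re
      rw [he]
      exact hr)
    (fun x z => (hc1 x z).symm.trans (hsq x z))
    (fun x z => (hc2 x z).symm.trans (hsq x z))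
    (by
      intro x y
      constructor
      · intro h
        obtain ⟨hx, rfl⟩ := (pmem _ _ _).1 h
        have hx' : x ∈ modT.domain := hfact.1 ▸ hx
        exact ⟨modT ⟨x, hx'⟩, (pmem _ _ _).2 ⟨hx', rfl⟩, hfact.2 x hx hx'⟩
      · rintro ⟨w, h, rfl⟩
        obtain ⟨hx', rfl⟩ := (pmem _ _ _).1 h
        have hx : x ∈ T.domain := hfact.1 ▸ hx'
        exact (pmem _ _ _).2 ⟨hx, hfact.2 x hx hx'⟩)
    (by
      intro x hx
      apply hU
      intro y hy
      rw [hinn.conj_symm, star_eq_zero]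
      apply q_re_ext
      intro q
      rw [← hinn.smul_right, hinn.re_symm, zero_mul]
      have hy0 : U₀ y = 0 := hy
      exact hx (op q • y) (by simp [hy0]))
    hkm
  rw [hran]
  refine ⟨r1, r2, r3, (commP_iff _ _).2 r4, ?_⟩
  intro B h1 h2
  ext x
  exact r5 (B.restrictScalars ℝ) ((commP_iff _ _).1 h1) ((commP_iff _ _).1 h2) x
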